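/- Let f : ℝⁿ → ℝⁿ be globally Lipschitz with constant L, A an n×n real matrix with operator norm ‖A‖, T > 0. Let q : [0,T] → ℝ be a measurable function with |q(t)| ≤ P for all t, and p* ∈ ℝ with |p*| ≤ P. Suppose x, x̄ : [0,T] → ℝⁿ are C¹ and satisfy ẋ(t) = f(x(t)) + q(t)·A x(t) and ẋ̄(t) = f(x̄(t)) + p*·A x̄(t) on [0,T]. If M ≥ 0 bounds ‖A x̄(t)‖ on [0,T] and there is C ≥ 0 with |∫_0^t (q(s) − p*) ds| ≤ C for all t ∈ [0,T], and moreover x̄ is Lipschitz on [0,T] with constant K, then for all t ∈ [0,T]: ‖x(t) − x̄(t)‖ ≤ (‖x(0) − x̄(0)‖ + C·M + C·‖A‖·(K + P·‖A‖·sup_{[0,T]}‖x̄‖ + sup_{[0,T]}‖f∘x̄‖)·T)·e^{(L + P‖A‖)t}. -/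

import Mathlib

open MeasureTheory Set

/-- **Grönwall's inequality** in integral form. -/
theorem le_mul_exp_of_le_add_mul_integral {u : ℝ → ℝ} {a k T : ℝ} (hk : 0 ≤ k)
    (hu : ContinuousOn u (Icc 0 T))
    (h : ∀ t ∈ Icc 0 T, u t ≤ a + k * ∫ s in (0 : ℝ)..t, u s) :
    ∀ t ∈ Icc 0 T, u t ≤ a * Real.exp (k * t) := by
  intro t ht
  have hT : 0 ≤ T := ht.1.trans ht.2
  have hint : IntegrableOn u (Icc 0 T) := hu.integrableOn_Icc
  have hderiv : ∀ s ∈ Ico 0 T,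
      HasDerivWithinAt (fun w => ∫ τ in (0 : ℝ)..w, u τ) (u s) (Ici s) s := by
    intro s hs
    have hnhds : Icc 0 T ∈ nhdsWithin s (Ioi s) :=
      Filter.mem_of_superset (Ioc_mem_nhdsGT hs.2) fun w hw => ⟨hs.1.trans hw.1.le, hw.2⟩
    refine intervalIntegral.integral_hasDerivWithinAt_right ?_ ?_ ?_ (t := Ioi s)
    · exact (hu.mono (Icc_subset_Icc_right hs.2.le)).intervalIntegrable_of_Icc hs.1
    · exact ⟨Icc 0 T, hnhds, hint.aestronglyMeasurable⟩
    · exact (hu s (Ico_subset_Icc_self hs)).mono_of_mem_nhdsWithin hnhds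
  have hbound := le_gronwallBound_of_liminf_deriv_right_le
    (f := fun w => ∫ τ in (0 : ℝ)..w, u τ) (f' := u) (δ := 0) (K := k) (ε := a)
    (a := 0) (b := T) (by
      rw [← uIcc_of_le hT] at hint ⊢
      exact intervalIntegral.continuousOn_primitive_interval hint)
    (fun s hs r hr => (hderiv s hs).liminf_right_slope_le hr) (by simp)
    (fun s hs => by linarith [h s (Ico_subset_Icc_self hs)]) t ht
  rw [sub_zero] at hbound
  calc u t ≤ a + k * gronwallBound 0 k a t := by grw [h t ht, hbound]
    _ = a * Real.exp (k * t) := by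
      rcases eq_or_ne k 0 with rfl | hk0
      · simp
      · rw [gronwallBound_of_K_ne_0 hk0]
        field_simp
        ring

/-- Integration by parts against a function whose primitive is bounded by `C`: scalar version. -/
theorem abs_integral_mul_le_of_abs_primitive_le {r g : ℝ → ℝ} {C t : ℝ} {D : NNReal} (ht : 0 ≤ t)
    (hr : IntervalIntegrable r volume 0 t)
    (hC : ∀ s ∈ Icc 0 t, |∫ τ in (0 : ℝ)..s, r τ| ≤ C)
    (hg : LipschitzOnWith D g (Icc 0 t)) :
    |∫ s in (0 : ℝ)..t, r s * g s| ≤ C * |g t| + C * D * t := by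
  have hC0 : 0 ≤ C := (abs_nonneg _).trans (hC t (right_mem_Icc.2 ht))
  have hparts := AbsolutelyContinuousOnInterval.integral_mul_deriv_eq_deriv_mul
    (hr.absolutelyContinuousOnInterval_intervalIntegral left_mem_uIcc)
    (LipschitzOnWith.absolutelyContinuousOnInterval (by rwa [uIcc_of_le ht]))
  have hcongr : ∫ s in (0 : ℝ)..t, deriv (fun w => ∫ τ in (0 : ℝ)..w, r τ) s * g s =
      ∫ s in (0 : ℝ)..t, r s * g s := by
    refine intervalIntegral.integral_congr_ae ?_
    filter_upwards [hr.ae_hasDerivAt_integral] with s hs hst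
    rw [(hs (uIoc_subset_uIcc hst) 0 left_mem_uIcc).deriv]
  have hrem : ‖∫ s in (0 : ℝ)..t, (∫ τ in (0 : ℝ)..s, r τ) * deriv g s‖ ≤ C * D * |t - 0| := by
    refine intervalIntegral.norm_integral_le_of_norm_le_const_ae ?_
    filter_upwards [compl_mem_ae_iff.2 (measure_singleton t)] with s hst hs
    rw [uIoc_of_le ht] at hs
    have hD : ‖deriv g s‖ ≤ D := norm_deriv_le_of_lipschitzOn
      (Icc_mem_nhds hs.1 (lt_of_le_of_ne hs.2 hst)) hg
    rw [norm_mul]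
    exact mul_le_mul (hC s (Ioc_subset_Icc_self hs)) hD (norm_nonneg _) hC0
  rw [hcongr, intervalIntegral.integral_same, zero_mul, sub_zero] at hparts
  rw [Real.norm_eq_abs, sub_zero, abs_of_nonneg ht] at hrem
  calc |∫ s in (0 : ℝ)..t, r s * g s|
      = |(∫ τ in (0 : ℝ)..t, r τ) * g t
          - ∫ s in (0 : ℝ)..t, (∫ τ in (0 : ℝ)..s, r τ) * deriv g s| := by
        rw [hparts]; congr 1; ring
    _ ≤ |∫ τ in (0 : ℝ)..t, r τ| * |g t| + C * D * t := by
        rw [← abs_mul]; exact (abs_sub _ _).trans (by gcongr)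
    _ ≤ C * |g t| + C * D * t := by gcongr; exact hC t (right_mem_Icc.2 ht)

/-- Integration by parts against a function whose primitive is bounded by `C`: vector version. -/
theorem norm_integral_smul_le_of_abs_primitive_le {E : Type*} [NormedAddCommGroup E]
    [NormedSpace ℝ E] [CompleteSpace E] {r : ℝ → ℝ} {g : ℝ → E} {C t : ℝ} {D : NNReal}
    (ht : 0 ≤ t) (hr : IntervalIntegrable r volume 0 t)
    (hC : ∀ s ∈ Icc 0 t, |∫ τ in (0 : ℝ)..s, r τ| ≤ C)
    (hg : LipschitzOnWith D g (Icc 0 t)) :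
    ‖∫ s in (0 : ℝ)..t, r s • g s‖ ≤ C * ‖g t‖ + C * D * t := by
  have hC0 : 0 ≤ C := (abs_nonneg _).trans (hC t (right_mem_Icc.2 ht))
  have hint : IntervalIntegrable (fun s => r s • g s) volume 0 t :=
    hr.smul_continuousOn (by rw [uIcc_of_le ht]; exact hg.continuousOn)
  obtain ⟨φ, hφ, hφv⟩ := exists_dual_vector'' ℝ (∫ s in (0 : ℝ)..t, r s • g s)
  have hφg : LipschitzOnWith D (fun s => φ (g s)) (Icc 0 t) := by
    have hφ1 : LipschitzWith 1 φ := φ.lipschitz.weaken (by exact_mod_cast hφ)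
    simpa only [one_mul] using! hφ1.comp_lipschitzOnWith hg
  calc ‖∫ s in (0 : ℝ)..t, r s • g s‖ = ∫ s in (0 : ℝ)..t, r s * φ (g s) := by
        simpa [← φ.intervalIntegral_comp_comm hint] using hφv.symm
    _ ≤ C * |φ (g t)| + C * D * t :=
        (le_abs_self _).trans (abs_integral_mul_le_of_abs_primitive_le ht hr hC hφg)
    _ ≤ C * ‖g t‖ + C * D * t := by
        gcongr
        simpa using φ.le_of_opNorm_le hφ (g t)


/-- **Grönwall-type estimate between the switched and the averaged solutions.**
Let `f : ℝⁿ → ℝⁿ` be globally Lipschitz with constant `L`, and let `A` be an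
`n×n` real matrix, viewed as a (continuous) linear operator on `ℝⁿ` so that
`‖A‖` is its operator norm, and `T > 0`.  Let `q : ℝ → ℝ` be measurable with
`|q t| ≤ P` on `[0,T]` and `p* ∈ ℝ` with `|p*| ≤ P`.  Suppose `x, x̄` are `C¹`
on `[0,T]` and satisfy `ẋ = f(x) + q(t) • A x` and `ẋ̄ = f(x̄) + p* • A x̄`
there.  If `M ≥ 0` bounds `‖A x̄(t)‖` on `[0,T]`, `C ≥ 0` bounds
`|∫_0^t (q − p*)|` on `[0,T]`, and `x̄` is `K`-Lipschitz on `[0,T]`, then for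
all `t ∈ [0,T]`:
`‖x t − x̄ t‖ ≤ (‖x 0 − x̄ 0‖ + C*M + C*‖A‖*(K + P*‖A‖*sup‖x̄‖ + sup‖f∘x̄‖)*T) * exp ((L + P*‖A‖)*t)`. -/
theorem ps_gronwall_estimate (n : ℕ)
    (f : (Fin n → ℝ) → (Fin n → ℝ)) (L : NNReal) (hf : LipschitzWith L f)
    (A : (Fin n → ℝ) →L[ℝ] (Fin n → ℝ)) (T : ℝ) (hT : 0 < T)
    (q : ℝ → ℝ) (hqm : Measurable q)
    (P : ℝ) (hqP : ∀ t ∈ Set.Icc (0:ℝ) T, |q t| ≤ P)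
    (pstar : ℝ) (hpP : |pstar| ≤ P)
    (x xb : ℝ → (Fin n → ℝ))
    (hx : ∀ t ∈ Set.Icc (0:ℝ) T,
      HasDerivWithinAt x (f (x t) + q t • A (x t)) (Set.Icc (0:ℝ) T) t)
    (hxb : ∀ t ∈ Set.Icc (0:ℝ) T,
      HasDerivWithinAt xb (f (xb t) + pstar • A (xb t)) (Set.Icc (0:ℝ) T) t)
    (M : ℝ) (hM0 : 0 ≤ M) (hM : ∀ t ∈ Set.Icc (0:ℝ) T, ‖A (xb t)‖ ≤ M)
    (C : ℝ) (hC0 : 0 ≤ C)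
    (hC : ∀ t ∈ Set.Icc (0:ℝ) T, |∫ s in (0:ℝ)..t, (q s - pstar)| ≤ C)
    (K : NNReal) (hK : LipschitzOnWith K xb (Set.Icc (0:ℝ) T)) :
    ∀ t ∈ Set.Icc (0:ℝ) T,
      ‖x t - xb t‖ ≤
        (‖x 0 - xb 0‖ + C * M +
            C * ‖A‖ *
              ((K : ℝ) + P * ‖A‖ * (⨆ s : Set.Icc (0:ℝ) T, ‖xb s‖) +
                (⨆ s : Set.Icc (0:ℝ) T, ‖f (xb s)‖)) * T) *
          Real.exp (((L : ℝ) + P * ‖A‖) * t) := by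
  have hP : 0 ≤ P := (abs_nonneg _).trans hpP
  have hxc : ContinuousOn x (Icc 0 T) := fun t ht => (hx t ht).continuousWithinAt
  have hxbc : ContinuousOn xb (Icc 0 T) := fun t ht => (hxb t ht).continuousWithinAt
  have hqi : IntervalIntegrable q volume 0 T := by
    rw [intervalIntegrable_iff_integrableOn_Icc_of_le hT.le]
    refine Measure.integrableOn_of_bounded (M := P) (by simp) hqm.aestronglyMeasurable ?_
    filter_upwards [ae_restrict_mem measurableSet_Icc] with t ht using hqP t ht
  set S₁ := ⨆ s : Icc (0 : ℝ) T, ‖xb s‖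
  set S₂ := ⨆ s : Icc (0 : ℝ) T, ‖f (xb s)‖
  have hS₁ : 0 ≤ S₁ := Real.iSup_nonneg fun _ => norm_nonneg _
  have hS₂ : 0 ≤ S₂ := Real.iSup_nonneg fun _ => norm_nonneg _
  refine le_mul_exp_of_le_add_mul_integral (u := fun t => ‖x t - xb t‖) (by positivity)
    (hxc.sub hxbc).norm fun t ht => ?_
  have hsub : Icc 0 t ⊆ Icc 0 T := Icc_subset_Icc_right ht.2
  have hxt := hxc.mono hsub
  have hxbt := hxbc.mono hsub
  have hqt : IntervalIntegrable q volume 0 t :=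
    hqi.mono_set (by rwa [uIcc_of_le ht.1, uIcc_of_le hT.le])
  have hAxb : LipschitzOnWith (‖A‖₊ * K) (fun s => A (xb s)) (Icc 0 t) :=
    A.lipschitz.comp_lipschitzOnWith (hK.mono hsub)
  have hosc_int : IntervalIntegrable (fun s => (q s - pstar) • A (xb s)) volume 0 t :=
    (hqt.sub intervalIntegrable_const).smul_continuousOn
      (by rw [uIcc_of_le ht.1]; exact hAxb.continuousOn)
  have hlip_int : IntervalIntegrable
      (fun s => (f (x s) - f (xb s)) + q s • A (x s - xb s)) volume 0 t := by
    refine IntervalIntegrable.add (ContinuousOn.intervalIntegrable ?_)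
      (hqt.smul_continuousOn ?_) <;> rw [uIcc_of_le ht.1]
    · exact (hf.continuous.comp_continuousOn hxt).sub (hf.continuous.comp_continuousOn hxbt)
    · exact A.continuous.comp_continuousOn (hxt.sub hxbt)
  have hftc : ∫ s in (0 : ℝ)..t, (((f (x s) - f (xb s)) + q s • A (x s - xb s)) +
      (q s - pstar) • A (xb s)) = (x t - xb t) - (x 0 - xb 0) := by
    refine intervalIntegral.integral_eq_sub_of_hasDerivAt_of_le (f := fun s => x s - xb s) ht.1
      (hxt.sub hxbt) (fun s hs => ?_) (hlip_int.add hosc_int)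
    have hsT : Icc 0 T ∈ nhds s := Icc_mem_nhds hs.1 (hs.2.trans_le ht.2)
    have hs' := hsub (Ioo_subset_Icc_self hs)
    refine (((hx s hs').hasDerivAt hsT).sub ((hxb s hs').hasDerivAt hsT)).congr_deriv ?_
    rw [map_sub]
    module
  rw [intervalIntegral.integral_add hlip_int hosc_int] at hftc
  have hosc : ‖∫ s in (0 : ℝ)..t, (q s - pstar) • A (xb s)‖ ≤
      C * ‖A (xb t)‖ + C * (‖A‖₊ * K : NNReal) * t :=
    norm_integral_smul_le_of_abs_primitive_le ht.1 (hqt.sub intervalIntegrable_const)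
      (fun s hs => hC s (hsub hs)) hAxb
  have hlip : ‖∫ s in (0 : ℝ)..t, ((f (x s) - f (xb s)) + q s • A (x s - xb s))‖ ≤
      (L + P * ‖A‖) * ∫ s in (0 : ℝ)..t, ‖x s - xb s‖ := by
    rw [← intervalIntegral.integral_const_mul]
    refine intervalIntegral.norm_integral_le_of_norm_le ht.1 (ae_of_all _ fun s hs => ?_)
      (ContinuousOn.intervalIntegrable ?_)
    · have hq := hqP s (hsub (Ioc_subset_Icc_self hs))
      calc ‖(f (x s) - f (xb s)) + q s • A (x s - xb s)‖
          ≤ ‖f (x s) - f (xb s)‖ + |q s| * ‖A (x s - xb s)‖ := by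
            simpa only [norm_smul, Real.norm_eq_abs] using norm_add_le _ (q s • A (x s - xb s))
        _ ≤ L * ‖x s - xb s‖ + P * (‖A‖ * ‖x s - xb s‖) := by
            gcongr
            · exact hf.norm_sub_le _ _
            · exact A.le_opNorm _
        _ = (L + P * ‖A‖) * ‖x s - xb s‖ := by ring
    · rw [uIcc_of_le ht.1]
      exact continuousOn_const.mul (hxt.sub hxbt).norm
  have hconst : C * ‖A (xb t)‖ + C * (‖A‖₊ * K : NNReal) * t ≤
      C * M + C * ‖A‖ * (K + P * ‖A‖ * S₁ + S₂) * T := by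
    have hPS : 0 ≤ P * ‖A‖ * S₁ := by positivity
    have ht0 := ht.1
    rw [NNReal.coe_mul, coe_nnnorm, ← mul_assoc]
    gcongr
    · exact hM t ht
    · linarith
    · exact ht.2
  calc ‖x t - xb t‖
      = ‖(x 0 - xb 0) + (∫ s in (0 : ℝ)..t, ((f (x s) - f (xb s)) + q s • A (x s - xb s)))
          + ∫ s in (0 : ℝ)..t, (q s - pstar) • A (xb s)‖ := by
        rw [add_assoc, hftc, add_sub_cancel]
    _ ≤ _ := norm_add₃_le
    _ ≤ _ := by linarith
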